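/- Let f be a bounded solution of the capillary problem on the sector Ω that is discontinuous at O, and assume the radial limit Rf(θ) exists for every θ ∈ (−α, α). Suppose f has an increasing lower fan: there exist α₁ ∈ [−α, α) and η > 0 such that Rf is constant on (−α, α₁] and strictly increasing on [α₁, α₁ + η] ∩ (−α, α); set β⁻ = α + α₁. Then for every λ ∈ (β⁻, π), 1 + A⁻_S(sin(λ − β⁻)/sin λ) ≤ sin(β⁻)/sin λ. -/

import Mathlib

open Real Set Filter MeasureTheory Topology

noncomputable section

/-- The open circular sector with vertex `O = (0,0)`, half-opening angle `α`, radius `δ`. -/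
def sector (α δ : ℝ) : Set (ℝ × ℝ) :=
  {p | ∃ r θ : ℝ, 0 < r ∧ r < δ ∧ -α < θ ∧ θ < α ∧ p = (r * Real.cos θ, r * Real.sin θ)}

/-- The gradient of `f : ℝ × ℝ → ℝ`. -/
def grad (f : ℝ × ℝ → ℝ) (p : ℝ × ℝ) : ℝ × ℝ :=
  (fderiv ℝ f p (1, 0), fderiv ℝ f p (0, 1))

/-- `Tf = ∇f / √(1 + |∇f|²)`. -/
def Tf (f : ℝ × ℝ → ℝ) (p : ℝ × ℝ) : ℝ × ℝ :=
  ((grad f p).1 / Real.sqrt (1 + (grad f p).1 ^ 2 + (grad f p).2 ^ 2),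
   (grad f p).2 / Real.sqrt (1 + (grad f p).1 ^ 2 + (grad f p).2 ^ 2))

/-- `Nf = div (Tf)`. -/
def Nf (f : ℝ × ℝ → ℝ) (p : ℝ × ℝ) : ℝ :=
  fderiv ℝ (fun q => (Tf f q).1) p (1, 0) + fderiv ℝ (fun q => (Tf f q).2) p (0, 1)

/-- Euclidean dot product on `ℝ × ℝ`. -/
def dot (v w : ℝ × ℝ) : ℝ := v.1 * w.1 + v.2 * w.2

/-- `f` is a bounded solution of the capillary problem `Nf = κ f + lam₀` in the sector,
`Tf ⬝ ν = cos γ` on the two open edges, with contact angles `γp, γm : (0,δ) → [0,π]`. -/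
structure IsCapillarySolution (α δ κ lam₀ : ℝ) (γp γm : ℝ → ℝ) (f : ℝ × ℝ → ℝ) : Prop where
  measurable_γp : Measurable γp
  measurable_γm : Measurable γm
  range_γp : ∀ s ∈ Ioo (0:ℝ) δ, γp s ∈ Icc 0 π
  range_γm : ∀ s ∈ Ioo (0:ℝ) δ, γm s ∈ Icc 0 π
  bounded : ∃ M : ℝ, ∀ p ∈ sector α δ, |f p| ≤ M
  smooth : ContDiffOn ℝ 2 f (sector α δ)
  pde : ∀ p ∈ sector α δ, Nf f p = κ * f p + lam₀
  edgeP_smooth : ∀ s ∈ Ioo (0:ℝ) δ, ContDiffAt ℝ 1 f (s * Real.cos α, s * Real.sin α)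
  edgeM_smooth : ∀ s ∈ Ioo (0:ℝ) δ, ContDiffAt ℝ 1 f (s * Real.cos α, -(s * Real.sin α))
  bcP : ∀ s ∈ Ioo (0:ℝ) δ,
    dot (Tf f (s * Real.cos α, s * Real.sin α)) (-Real.sin α, Real.cos α) = Real.cos (γp s)
  bcM : ∀ s ∈ Ioo (0:ℝ) δ,
    dot (Tf f (s * Real.cos α, -(s * Real.sin α))) (-Real.sin α, -Real.cos α) = Real.cos (γm s)

/-- `L` is the radial limit `Rf(θ)` of `f` in direction `θ`. -/
def RadialLimitAt (f : ℝ × ℝ → ℝ) (θ L : ℝ) : Prop :=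
  Tendsto (fun r => f (r * Real.cos θ, r * Real.sin θ)) (𝓝[>] (0:ℝ)) (𝓝 L)

/-- `f` is discontinuous at the corner `O`: `f(x)` has no limit as `Ω ∋ x → O`. -/
def DiscontinuousAtCorner (α δ : ℝ) (f : ℝ × ℝ → ℝ) : Prop :=
  ¬ ∃ L : ℝ, Tendsto f (𝓝[sector α δ] ((0:ℝ), (0:ℝ))) (𝓝 L)

/-- `A_I(b) = liminf_{ε→0⁺} (1/ε) ∫₀^{bε} cos γ(t) dt`. -/
def fanAI (γ : ℝ → ℝ) (b : ℝ) : ℝ :=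
  liminf (fun ε : ℝ => ε⁻¹ * ∫ t in Ioo (0:ℝ) (b * ε), Real.cos (γ t)) (𝓝[>] (0:ℝ))

/-- `A_S(b) = limsup_{ε→0⁺} (1/ε) ∫₀^{bε} cos γ(t) dt`. -/
def fanAS (γ : ℝ → ℝ) (b : ℝ) : ℝ :=
  limsup (fun ε : ℝ => ε⁻¹ * ∫ t in Ioo (0:ℝ) (b * ε), Real.cos (γ t)) (𝓝[>] (0:ℝ))

lemma piola (V1 V2 h : ℝ × ℝ → ℝ) (c1 c2 d1 d2 e1 e2 : ℝ → ℝ) (ρ ε a b : ℝ)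
    (hρ : ρ ≤ ε) (hab : a ≤ b)
    (hc1 : ∀ s ∈ Icc a b, HasDerivAt c1 (d1 s) s) (hc2 : ∀ s ∈ Icc a b, HasDerivAt c2 (d2 s) s)
    (hd1 : ∀ s ∈ Icc a b, HasDerivAt d1 (e1 s) s) (hd2 : ∀ s ∈ Icc a b, HasDerivAt d2 (e2 s) s)
    (hV1 : ∀ t ∈ Icc ρ ε, ∀ s ∈ Icc a b, ContinuousAt V1 (t * c1 s, t * c2 s))
    (hV2 : ∀ t ∈ Icc ρ ε, ∀ s ∈ Icc a b, ContinuousAt V2 (t * c1 s, t * c2 s))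
    (hh : ∀ t ∈ Icc ρ ε, ∀ s ∈ Icc a b, ContinuousAt h (t * c1 s, t * c2 s))
    (hdiv : ∀ t ∈ Ioo ρ ε, ∀ s ∈ Ioo a b, DifferentiableAt ℝ V1 (t * c1 s, t * c2 s) ∧
      DifferentiableAt ℝ V2 (t * c1 s, t * c2 s) ∧
      fderiv ℝ V1 (t * c1 s, t * c2 s) (1, 0) + fderiv ℝ V2 (t * c1 s, t * c2 s) (0, 1)
        = h (t * c1 s, t * c2 s)) :
    (∫ t in ρ..ε, ∫ s in a..b, t * (c1 s * d2 s - d1 s * c2 s) * h (t * c1 s, t * c2 s)) =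
      (((∫ t in ρ..ε, (V2 (t * c1 b, t * c2 b) * c1 b - V1 (t * c1 b, t * c2 b) * c2 b)) -
        (∫ t in ρ..ε, (V2 (t * c1 a, t * c2 a) * c1 a - V1 (t * c1 a, t * c2 a) * c2 a))) +
      (∫ s in a..b, ε * (V1 (ε * c1 s, ε * c2 s) * d2 s - V2 (ε * c1 s, ε * c2 s) * d1 s))) -
      (∫ s in a..b, ρ * (V1 (ρ * c1 s, ρ * c2 s) * d2 s - V2 (ρ * c1 s, ρ * c2 s) * d1 s)) := by
  set X : ℝ × ℝ → ℝ × ℝ := fun p => (p.1 * c1 p.2, p.1 * c2 p.2) with hX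
  set u : ℝ × ℝ → ℝ := fun p => p.1 * (V1 (X p) * d2 p.2 - V2 (X p) * d1 p.2) with hu
  set v : ℝ × ℝ → ℝ := fun p => V2 (X p) * c1 p.2 - V1 (X p) * c2 p.2 with hv
  set G : ℝ × ℝ → ℝ := fun p => p.1 * (c1 p.2 * d2 p.2 - d1 p.2 * c2 p.2) * h (X p) with hG
  have hXc : ∀ p ∈ Icc ρ ε ×ˢ Icc a b, ContinuousAt X p := by
    rintro p ⟨h1, h2⟩
    have := (hc1 _ h2).continuousAt
    have := (hc2 _ h2).continuousAt
    have e1 : ContinuousAt (fun p : ℝ × ℝ => c1 p.2) p := by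
      exact ContinuousAt.comp (f := Prod.snd) (g := c1) (by assumption) continuousAt_snd
    have e2 : ContinuousAt (fun p : ℝ × ℝ => c2 p.2) p := by
      exact ContinuousAt.comp (f := Prod.snd) (g := c2) (by assumption) continuousAt_snd
    exact (continuousAt_fst.mul e1).prodMk (continuousAt_fst.mul e2)
  have hsnd : ∀ (q : ℝ → ℝ) (q' : ℝ) (p : ℝ × ℝ), HasDerivAt q q' p.2 →
      ContinuousAt (fun p : ℝ × ℝ => q p.2) p := by
    intro q q' p hq
    exact ContinuousAt.comp (f := Prod.snd) (g := q) hq.continuousAt continuousAt_snd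
  have hcomp : ∀ (W : ℝ × ℝ → ℝ), (∀ t ∈ Icc ρ ε, ∀ s ∈ Icc a b,
      ContinuousAt W (t * c1 s, t * c2 s)) → ∀ p ∈ Icc ρ ε ×ˢ Icc a b,
      ContinuousAt (fun p => W (X p)) p := by
    intro W hW p hp
    exact ContinuousAt.comp (f := X) (g := W) (hW _ hp.1 _ hp.2) (hXc p hp)
  have huc : ContinuousOn u (Icc ρ ε ×ˢ Icc a b) := by
    intro p hp
    exact (continuousAt_fst.mul (((hcomp _ hV1 p hp).mul (hsnd _ _ p (hd2 _ hp.2))).sub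
      ((hcomp _ hV2 p hp).mul (hsnd _ _ p (hd1 _ hp.2))))).continuousWithinAt
  have hvc : ContinuousOn v (Icc ρ ε ×ˢ Icc a b) := by
    intro p hp
    exact (((hcomp _ hV2 p hp).mul (hsnd _ _ p (hc1 _ hp.2))).sub
      ((hcomp _ hV1 p hp).mul (hsnd _ _ p (hc2 _ hp.2)))).continuousWithinAt
  have hGc : ContinuousOn G (Icc ρ ε ×ˢ Icc a b) := by
    intro p hp
    exact ((continuousAt_fst.mul (((hsnd _ _ p (hc1 _ hp.2)).mul (hsnd _ _ p (hd2 _ hp.2))).sub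
      ((hsnd _ _ p (hd1 _ hp.2)).mul (hsnd _ _ p (hc2 _ hp.2))))).mul
      (hcomp _ hh p hp)).continuousWithinAt
  have key : ∀ p ∈ Ioo ρ ε ×ˢ Ioo a b, DifferentiableAt ℝ u p ∧ DifferentiableAt ℝ v p ∧
      fderiv ℝ u p (1, 0) + fderiv ℝ v p (0, 1) = G p := by
    rintro ⟨t, s⟩ ⟨ht, hs⟩
    have hs' : s ∈ Icc a b := Ioo_subset_Icc_self hs
    obtain ⟨hA, hB, hE⟩ := hdiv t ht s hs
    have lift : ∀ (q : ℝ → ℝ) (q' : ℝ), HasDerivAt q q' s →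
        HasFDerivAt (fun p : ℝ × ℝ => q p.2) (q' • ContinuousLinearMap.snd ℝ ℝ ℝ) (t, s) := by
      intro q q' hq
      exact HasDerivAt.comp_hasFDerivAt (f := Prod.snd) (h₂ := q) (t, s) hq
        (hasFDerivAt_snd)
    have f1 : HasFDerivAt (fun p : ℝ × ℝ => p.1) (ContinuousLinearMap.fst ℝ ℝ ℝ) (t, s) :=
      hasFDerivAt_fst
    have x1 := f1.mul (lift _ _ (hc1 s hs'))
    have x2 := f1.mul (lift _ _ (hc2 s hs'))
    have xx : HasFDerivAt X _ (t, s) := x1.prodMk x2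
    have w1 : HasFDerivAt (fun p => V1 (X p)) _ (t, s) :=
      HasFDerivAt.comp (f := X) (g := V1) (t, s) hA.hasFDerivAt xx
    have w2 : HasFDerivAt (fun p => V2 (X p)) _ (t, s) :=
      HasFDerivAt.comp (f := X) (g := V2) (t, s) hB.hasFDerivAt xx
    have U : HasFDerivAt u _ (t, s) := f1.mul ((w1.mul (lift _ _ (hd2 s hs'))).sub
      (w2.mul (lift _ _ (hd1 s hs'))))
    have W : HasFDerivAt v _ (t, s) := (w2.mul (lift _ _ (hc1 s hs'))).sub
      (w1.mul (lift _ _ (hc2 s hs')))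
    refine ⟨U.differentiableAt, W.differentiableAt, ?_⟩
    rw [U.fderiv, W.fderiv]
    have lin : ∀ (A : ℝ × ℝ →L[ℝ] ℝ) (x y : ℝ), A (x, y) = x * A (1, 0) + y * A (0, 1) := by
      intro A x y
      have : ((x, y) : ℝ × ℝ) = x • (1, 0) + y • (0, 1) := by simp
      rw [this, map_add, map_smul, map_smul]; simp
    simp [hG, hX, ← hE]
    rw [lin _ (c1 s) (c2 s), lin (fderiv ℝ V1 _) (t * d1 s) (t * d2 s), lin (fderiv ℝ V2 _) (c1 s) (c2 s),
      lin (fderiv ℝ V2 _) (t * d1 s) (t * d2 s)]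
    ring
  have main := integral2_divergence_prod_of_hasFDerivAt_off_countable u v (fderiv ℝ u) (fderiv ℝ v)
    ρ a ε b ∅ countable_empty (by rwa [uIcc_of_le hρ, uIcc_of_le hab])
    (by rwa [uIcc_of_le hρ, uIcc_of_le hab])
    (by
      intro x hx; rw [min_eq_left hρ, min_eq_left hab, max_eq_right hρ, max_eq_right hab] at hx
      exact (key x hx.1).1.hasFDerivAt)
    (by
      intro x hx; rw [min_eq_left hρ, min_eq_left hab, max_eq_right hρ, max_eq_right hab] at hx
      exact (key x hx.1).2.1.hasFDerivAt)
    (by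
      rw [uIcc_of_le hρ, uIcc_of_le hab]
      have h1 : IntegrableOn G (Icc ρ ε ×ˢ Icc a b) :=
        hGc.integrableOn_compact (isCompact_Icc.prod isCompact_Icc)
      have hae : (Ioo ρ ε ×ˢ Ioo a b : Set (ℝ × ℝ)) =ᵐ[volume] (Icc ρ ε ×ˢ Icc a b) :=
        Measure.set_prod_ae_eq Ioo_ae_eq_Icc Ioo_ae_eq_Icc
      rw [← integrableOn_congr_set_ae hae] at h1 ⊢
      refine h1.congr_fun (fun p hp => (key p hp).2.2.symm) (measurableSet_Ioo.prod measurableSet_Ioo))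
  rw [← main]
  rw [intervalIntegral.integral_of_le hρ, intervalIntegral.integral_of_le hρ,
    integral_Ioc_eq_integral_Ioo, integral_Ioc_eq_integral_Ioo]
  refine setIntegral_congr_fun measurableSet_Ioo fun t ht => ?_
  rw [intervalIntegral.integral_of_le hab, intervalIntegral.integral_of_le hab,
    integral_Ioc_eq_integral_Ioo, integral_Ioc_eq_integral_Ioo]
  refine setIntegral_congr_fun measurableSet_Ioo fun s hs => ?_
  exact ((key (t, s) ⟨ht, hs⟩).2.2).symm

lemma box_int (G : ℝ × ℝ → ℝ) (ρ ε a b : ℝ) (hρ : ρ ≤ ε) (hab : a ≤ b)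
    (hG : ∀ t ∈ Icc ρ ε, ∀ s ∈ Icc a b, ContinuousAt G (t, s)) :
    IntervalIntegrable (fun t => ∫ s in a..b, G (t, s)) volume ρ ε := by
  have hGc : ContinuousOn G (Icc ρ ε ×ˢ Icc a b) := fun p hp =>
    (hG p.1 hp.1 p.2 hp.2).continuousWithinAt
  have h1 : IntegrableOn G (Icc ρ ε ×ˢ Icc a b) :=
    hGc.integrableOn_compact (isCompact_Icc.prod isCompact_Icc)
  rw [IntegrableOn, Measure.volume_eq_prod, ← Measure.prod_restrict] at h1
  have h2 := h1.integral_prod_left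
  rw [intervalIntegrable_iff_integrableOn_Icc_of_le hρ]
  refine h2.congr (Eventually.of_forall fun t => ?_)
  simp only
  rw [intervalIntegral.integral_of_le hab, integral_Icc_eq_integral_Ioc]

lemma sector_isOpen {α δ : ℝ} (hα : α ∈ Ioo 0 π) : IsOpen (sector α δ) := by
  have h : sector α δ = polarCoord.symm '' (Ioo 0 δ ×ˢ Ioo (-α) α) := by
    ext p
    constructor
    · rintro ⟨r, θ, h1, h2, h3, h4, rfl⟩
      exact ⟨(r, θ), ⟨⟨h1, h2⟩, ⟨h3, h4⟩⟩, by simp [polarCoord]⟩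
    · rintro ⟨⟨r, θ⟩, ⟨⟨h1, h2⟩, ⟨h3, h4⟩⟩, rfl⟩
      exact ⟨r, θ, h1, h2, h3, h4, by simp [polarCoord]⟩
  rw [h]
  apply polarCoord.isOpen_image_symm_of_subset_target (isOpen_Ioo.prod isOpen_Ioo)
  rintro ⟨r, θ⟩ ⟨h1, h2⟩
  simp only [polarCoord, mem_prod, mem_Ioi, mem_Ioo] at *
  exact ⟨h1.1, by linarith [hα.2], by linarith [hα.2]⟩

lemma mem_sec {α δ r θ : ℝ} (h1 : 0 < r) (h2 : r < δ) (h3 : -α < θ) (h4 : θ < α) :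
    (r * Real.cos θ, r * Real.sin θ) ∈ sector α δ := ⟨r, θ, h1, h2, h3, h4, rfl⟩

lemma grad_cont {f : ℝ × ℝ → ℝ} {p : ℝ × ℝ} (h : ContDiffAt ℝ 1 f p) (v : ℝ × ℝ) :
    ContinuousAt (fun q => fderiv ℝ f q v) p :=
  (h.continuousAt_fderiv (by simp)).clm_apply continuousAt_const

lemma grad_diff {f : ℝ × ℝ → ℝ} {p : ℝ × ℝ} (h : ContDiffAt ℝ 2 f p) (v : ℝ × ℝ) :
    DifferentiableAt ℝ (fun q => fderiv ℝ f q v) p := by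
  have : ContDiffAt ℝ 1 (fderiv ℝ f) p := h.fderiv_right (by norm_num)
  exact (this.differentiableAt (by simp)).clm_apply (differentiableAt_const _)

lemma W_pos (a b : ℝ) : 0 < 1 + a ^ 2 + b ^ 2 := by positivity

lemma Tf_cont {f : ℝ × ℝ → ℝ} {p : ℝ × ℝ} (h : ContDiffAt ℝ 1 f p) :
    ContinuousAt (fun q => (Tf f q).1) p ∧ ContinuousAt (fun q => (Tf f q).2) p := by
  have h1 := grad_cont h (1, 0)
  have h2 := grad_cont h (0, 1)
  have h3 : ContinuousAt (fun q => Real.sqrt (1 + (grad f q).1 ^ 2 + (grad f q).2 ^ 2)) p :=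
    ((continuousAt_const.add (h1.pow 2)).add (h2.pow 2)).sqrt
  have h4 := (Real.sqrt_pos.2 (W_pos (grad f p).1 (grad f p).2)).ne'
  exact ⟨h1.div h3 h4, h2.div h3 h4⟩

lemma Tf_diff {f : ℝ × ℝ → ℝ} {p : ℝ × ℝ} (h : ContDiffAt ℝ 2 f p) :
    DifferentiableAt ℝ (fun q => (Tf f q).1) p ∧ DifferentiableAt ℝ (fun q => (Tf f q).2) p := by
  have h1 := grad_diff h (1, 0)
  have h2 := grad_diff h (0, 1)
  have h3 : DifferentiableAt ℝ (fun q => Real.sqrt (1 + (grad f q).1 ^ 2 + (grad f q).2 ^ 2)) p :=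
    (((differentiableAt_const _).add (h1.pow 2)).add (h2.pow 2)).sqrt (W_pos _ _).ne'
  have h4 : (fun q => Real.sqrt (1 + (grad f q).1 ^ 2 + (grad f q).2 ^ 2)) p ≠ 0 :=
    (Real.sqrt_pos.2 (W_pos (grad f p).1 (grad f p).2)).ne'
  have h5 := h3.inv h4
  simp only [Tf, div_eq_mul_inv]
  exact ⟨h1.mul h5, h2.mul h5⟩

lemma Tf_norm (f : ℝ × ℝ → ℝ) (p : ℝ × ℝ) : (Tf f p).1 ^ 2 + (Tf f p).2 ^ 2 ≤ 1 := by
  have h := W_pos (grad f p).1 (grad f p).2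
  simp only [Tf, div_pow, Real.sq_sqrt h.le]
  rw [← add_div, div_le_one h]
  linarith

lemma Tf_bound (f : ℝ × ℝ → ℝ) (p : ℝ × ℝ) (a b k : ℝ) (hk : 0 ≤ k) (h : a ^ 2 + b ^ 2 ≤ k ^ 2) :
    |(Tf f p).1 * a + (Tf f p).2 * b| ≤ k := by
  apply abs_le_of_sq_le_sq _ hk
  have := Tf_norm f p
  nlinarith [sq_nonneg ((Tf f p).1 * b - (Tf f p).2 * a), sq_nonneg a, sq_nonneg b]

lemma Tf_energy (f : ℝ × ℝ → ℝ) (p : ℝ × ℝ) (a b : ℝ) (h : a ^ 2 + b ^ 2 = 1) :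
    (grad f p).1 * a + (grad f p).2 * b - 1 ≤
      (grad f p).1 * (Tf f p).1 + (grad f p).2 * (Tf f p).2 := by
  set g1 := (grad f p).1
  set g2 := (grad f p).2
  have hw := W_pos g1 g2
  set w := Real.sqrt (1 + g1 ^ 2 + g2 ^ 2) with hwd
  have hw0 : 0 < w := Real.sqrt_pos.2 hw
  have hw2 : w ^ 2 = 1 + g1 ^ 2 + g2 ^ 2 := Real.sq_sqrt hw.le
  have hw1 : 1 ≤ w := by nlinarith [sq_nonneg g1, sq_nonneg g2]
  have e : g1 * (Tf f p).1 + g2 * (Tf f p).2 = (w ^ 2 - 1) / w := by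
    have : Tf f p = (g1 / w, g2 / w) := rfl
    rw [this, hw2]; ring
  rw [e, le_div_iff₀ hw0]
  have hs : g1 * a + g2 * b ≤ w := by
    apply le_of_sq_le_sq _ hw0.le
    nlinarith [sq_nonneg (g1 * b - g2 * a)]
  nlinarith

lemma cda {α δ κ lam₀ : ℝ} {γp γm : ℝ → ℝ} {f : ℝ × ℝ → ℝ}
    (hα : α ∈ Ioo 0 π) (hsol : IsCapillarySolution α δ κ lam₀ γp γm f) {p : ℝ × ℝ}
    (hp : p ∈ sector α δ) : ContDiffAt ℝ 2 f p :=
  hsol.smooth.contDiffAt ((sector_isOpen hα).mem_nhds hp)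

lemma ray_cont (W : ℝ × ℝ → ℝ) (x y t : ℝ) (h : ContinuousAt W (t * x, t * y)) :
    ContinuousAt (fun t => W (t * x, t * y)) t :=
  ContinuousAt.comp (f := fun t : ℝ => (t * x, t * y)) (g := W) h (by fun_prop)

lemma arc_cont (W : ℝ × ℝ → ℝ) (t s : ℝ) (h : ContinuousAt W (t * Real.cos s, t * Real.sin s)) :
    ContinuousAt (fun s => W (t * Real.cos s, t * Real.sin s)) s :=
  ContinuousAt.comp (f := fun s : ℝ => (t * Real.cos s, t * Real.sin s)) (g := W) h (by fun_prop)

lemma ii_of_contAt {g : ℝ → ℝ} {a b : ℝ} (hab : a ≤ b) (h : ∀ t ∈ Icc a b, ContinuousAt g t) :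
    IntervalIntegrable g volume a b := by
  apply ContinuousOn.intervalIntegrable
  rw [uIcc_of_le hab]
  exact fun t ht => (h t ht).continuousWithinAt

lemma energy_ineq {α δ κ lam₀ : ℝ} {γp γm : ℝ → ℝ} {f : ℝ × ℝ → ℝ}
    (hα : α ∈ Ioo 0 π) (hsol : IsCapillarySolution α δ κ lam₀ γp γm f)
    (M K c₀ θ₁ θ₂ ρ ε : ℝ) (hM : ∀ p ∈ sector α δ, |f p - c₀| ≤ M)
    (hK : ∀ p ∈ sector α δ, |κ * f p + lam₀| ≤ K)
    (h1 : -α < θ₁) (h12 : θ₁ < θ₂) (h2 : θ₂ < α) (hρ : 0 < ρ) (hρε : ρ ≤ ε) (hε : ε < δ) :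
    (∫ t in ρ..ε, (f (t * Real.cos θ₂, t * Real.sin θ₂) - f (t * Real.cos θ₁, t * Real.sin θ₁)
        - (1 + M * K) * (θ₂ - θ₁) * ε)) ≤
      (∫ t in ρ..ε, (f (t * Real.cos θ₂, t * Real.sin θ₂) - c₀) *
        ((Tf f (t * Real.cos θ₂, t * Real.sin θ₂)).2 * Real.cos θ₂ -
          (Tf f (t * Real.cos θ₂, t * Real.sin θ₂)).1 * Real.sin θ₂)) -
      (∫ t in ρ..ε, (f (t * Real.cos θ₁, t * Real.sin θ₁) - c₀) *
        ((Tf f (t * Real.cos θ₁, t * Real.sin θ₁)).2 * Real.cos θ₁ -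
          (Tf f (t * Real.cos θ₁, t * Real.sin θ₁)).1 * Real.sin θ₁)) +
      ε * (∫ s in θ₁..θ₂, |f (ε * Real.cos s, ε * Real.sin s) - c₀|) + ρ * M * (θ₂ - θ₁) := by
  have hmem : ∀ t ∈ Icc ρ ε, ∀ s ∈ Icc θ₁ θ₂, (t * Real.cos s, t * Real.sin s) ∈ sector α δ :=
    fun t ht s hs => mem_sec (by linarith [ht.1]) (by linarith [ht.2]) (by linarith [hs.1])
      (by linarith [hs.2])
  have hCD : ∀ p ∈ sector α δ, ContDiffAt ℝ 2 f p := fun p hp => cda hα hsol hp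
  have hCD1 : ∀ p ∈ sector α δ, ContDiffAt ℝ 1 f p := fun p hp => (hCD p hp).of_le (by norm_num)
  have hfc : ∀ p ∈ sector α δ, ContinuousAt f p := fun p hp => (hCD p hp).continuousAt
  set h : ℝ × ℝ → ℝ := fun p => ((grad f p).1 * (Tf f p).1 + (grad f p).2 * (Tf f p).2) +
    (f p - c₀) * (κ * f p + lam₀) with hh
  have hhc : ∀ p ∈ sector α δ, ContinuousAt h p := by
    intro p hp
    have a1 := grad_cont (hCD1 p hp) (1, 0)
    have a2 := grad_cont (hCD1 p hp) (0, 1)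
    have a3 := Tf_cont (hCD1 p hp)
    have a4 := hfc p hp
    exact ((a1.mul a3.1).add (a2.mul a3.2)).add ((a4.sub continuousAt_const).mul
      ((continuousAt_const.mul a4).add continuousAt_const))
  have P := piola (fun p => (f p - c₀) * (Tf f p).1) (fun p => (f p - c₀) * (Tf f p).2) h
    Real.cos Real.sin (fun s => -Real.sin s) Real.cos (fun s => -Real.cos s) (fun s => -Real.sin s)
    ρ ε θ₁ θ₂ hρε h12.le (fun s _ => Real.hasDerivAt_cos s) (fun s _ => Real.hasDerivAt_sin s)
    (fun s _ => (Real.hasDerivAt_sin s).neg) (fun s _ => Real.hasDerivAt_cos s)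
    (fun t ht s hs => ((hfc _ (hmem t ht s hs)).sub continuousAt_const).mul
      (Tf_cont (hCD1 _ (hmem t ht s hs))).1)
    (fun t ht s hs => ((hfc _ (hmem t ht s hs)).sub continuousAt_const).mul
      (Tf_cont (hCD1 _ (hmem t ht s hs))).2)
    (fun t ht s hs => hhc _ (hmem t ht s hs))
    (by
      intro t ht s hs
      have hp := hmem t (Ioo_subset_Icc_self ht) s (Ioo_subset_Icc_self hs)
      set p := (t * Real.cos s, t * Real.sin s) with hpd
      have b1 : DifferentiableAt ℝ (fun q => f q - c₀) p :=
        ((hCD p hp).differentiableAt (by norm_num)).sub (differentiableAt_const _)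
      have b2 := Tf_diff (hCD p hp)
      refine ⟨b1.mul b2.1, b1.mul b2.2, ?_⟩
      have e1 := (b1.hasFDerivAt.mul b2.1.hasFDerivAt).fderiv
      have e2 := (b1.hasFDerivAt.mul b2.2.hasFDerivAt).fderiv
      have e3 : fderiv ℝ (fun q => f q - c₀) p = fderiv ℝ f p := by
        rw [fderiv_sub_const]
      have pde := hsol.pde p hp
      rw [Nf] at pde
      simp only [Pi.mul_def] at e1 e2
      rw [e1, e2, e3]
      simp only [hh]
      rw [← pde]
      simp [grad]
      ring)
  -- lower bound of the left side
  have L : (∫ t in ρ..ε, (f (t * Real.cos θ₂, t * Real.sin θ₂) -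
        f (t * Real.cos θ₁, t * Real.sin θ₁) - (1 + M * K) * (θ₂ - θ₁) * ε)) ≤
      ∫ t in ρ..ε, ∫ s in θ₁..θ₂, t * (Real.cos s * Real.cos s - -Real.sin s * Real.sin s) *
        h (t * Real.cos s, t * Real.sin s) := by
    have hθ₁ : θ₁ ∈ Icc θ₁ θ₂ := ⟨le_rfl, h12.le⟩
    have hθ₂ : θ₂ ∈ Icc θ₁ θ₂ := ⟨h12.le, le_rfl⟩
    apply intervalIntegral.integral_mono_on hρε
    · apply ii_of_contAt hρε
      intro t ht
      exact ((ray_cont f _ _ t (hfc _ (hmem t ht _ hθ₂))).sub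
        (ray_cont f _ _ t (hfc _ (hmem t ht _ hθ₁)))).sub continuousAt_const
    · apply box_int (fun p => p.1 * (Real.cos p.2 * Real.cos p.2 - -Real.sin p.2 * Real.sin p.2) *
        h (p.1 * Real.cos p.2, p.1 * Real.sin p.2)) ρ ε θ₁ θ₂ hρε h12.le
      intro t ht s hs
      refine ContinuousAt.mul (by fun_prop) ?_
      exact ContinuousAt.comp (f := fun p : ℝ × ℝ => (p.1 * Real.cos p.2, p.1 * Real.sin p.2))
        (g := h) (hhc _ (hmem t ht s hs)) (by fun_prop)
    · intro t ht
      have ht0 : 0 < t := lt_of_lt_of_le hρ ht.1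
      set g : ℝ → ℝ := fun s => t * ((grad f (t * Real.cos s, t * Real.sin s)).1 * (-Real.sin s) +
        (grad f (t * Real.cos s, t * Real.sin s)).2 * Real.cos s) with hg
      have hgc : ∀ s ∈ Icc θ₁ θ₂, ContinuousAt g s := by
        intro s hs
        have a1 := arc_cont _ t s (grad_cont (hCD1 _ (hmem t ht s hs)) (1, 0))
        have a2 := arc_cont _ t s (grad_cont (hCD1 _ (hmem t ht s hs)) (0, 1))
        exact continuousAt_const.mul ((a1.mul (by fun_prop)).add (a2.mul (by fun_prop)))
      have ftc : ∫ s in θ₁..θ₂, g s = f (t * Real.cos θ₂, t * Real.sin θ₂) -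
          f (t * Real.cos θ₁, t * Real.sin θ₁) := by
        refine intervalIntegral.integral_eq_sub_of_hasDerivAt
          (f := fun s => f (t * Real.cos s, t * Real.sin s)) ?_ (ii_of_contAt h12.le hgc)
        intro s hs
        rw [uIcc_of_le h12.le] at hs
        have b1 := ((hCD1 _ (hmem t ht s hs)).differentiableAt (by norm_num)).hasFDerivAt
        have b2 : HasDerivAt (fun s => (t * Real.cos s, t * Real.sin s))
            (t * (-Real.sin s), t * Real.cos s) s :=
          ((Real.hasDerivAt_cos s).const_mul t).prodMk ((Real.hasDerivAt_sin s).const_mul t)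
        have b3 : HasDerivAt (fun s => f (t * Real.cos s, t * Real.sin s)) _ s :=
          HasFDerivAt.comp_hasDerivAt s b1 b2
        refine b3.congr_deriv ?_
        have : ((t * (-Real.sin s), t * Real.cos s) : ℝ × ℝ) =
          (t * (-Real.sin s)) • (1, 0) + (t * Real.cos s) • (0, 1) := by simp
        rw [this, map_add, map_smul, map_smul]
        simp only [hg, grad, smul_eq_mul]
        ring
      have e : f (t * Real.cos θ₂, t * Real.sin θ₂) -
          f (t * Real.cos θ₁, t * Real.sin θ₁) - (1 + M * K) * (θ₂ - θ₁) * ε =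
          ∫ s in θ₁..θ₂, (g s - (1 + M * K) * ε) := by
        rw [intervalIntegral.integral_sub (ii_of_contAt h12.le hgc) (by simp), ftc]
        simp; ring
      rw [e]
      apply intervalIntegral.integral_mono_on h12.le
      · exact ii_of_contAt h12.le fun s hs => (hgc s hs).sub continuousAt_const
      · apply ii_of_contAt h12.le
        intro s hs
        exact ContinuousAt.mul (by fun_prop) (arc_cont h t s (hhc _ (hmem t ht s hs)))
      · intro s hs
        have hp := hmem t ht s hs
        have q1 := Tf_energy f (t * Real.cos s, t * Real.sin s) (-Real.sin s) (Real.cos s)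
          (by nlinarith [Real.sin_sq_add_cos_sq s])
        have q2 := hM _ hp
        have q3 := hK _ hp
        have q4 : |(f (t * Real.cos s, t * Real.sin s) - c₀) *
            (κ * f (t * Real.cos s, t * Real.sin s) + lam₀)| ≤ M * K := by
          rw [abs_mul]; gcongr
          exact (abs_nonneg _).trans q2
        have q5 := (abs_le.1 q4).1
        have q6 : (Real.cos s * Real.cos s - -Real.sin s * Real.sin s) = 1 := by
          nlinarith [Real.sin_sq_add_cos_sq s]
        rw [q6, mul_one]
        have q7 : 0 ≤ M * K := (abs_nonneg _).trans q4
        have q8 := mul_le_mul_of_nonneg_left (add_le_add q1 q5) ht0.le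
        have q9 : t * (1 + M * K) ≤ ε * (1 + M * K) := by
          have := ht.2
          gcongr
        simp only [hg, hh] at *
        nlinarith
  have U1 : |∫ s in θ₁..θ₂, ε * ((f (ε * Real.cos s, ε * Real.sin s) - c₀) *
      (Tf f (ε * Real.cos s, ε * Real.sin s)).1 * Real.cos s -
      (f (ε * Real.cos s, ε * Real.sin s) - c₀) *
      (Tf f (ε * Real.cos s, ε * Real.sin s)).2 * -Real.sin s)| ≤
      ε * (∫ s in θ₁..θ₂, |f (ε * Real.cos s, ε * Real.sin s) - c₀|) := by
    rw [intervalIntegral.integral_const_mul, abs_mul, abs_of_pos (by linarith)]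
    gcongr ?_ * ?_
    · linarith
    rw [← Real.norm_eq_abs]
    apply intervalIntegral.norm_integral_le_of_norm_le h12.le
    · refine Eventually.of_forall fun s _ => ?_
      have := Tf_bound f (ε * Real.cos s, ε * Real.sin s) (Real.cos s) (Real.sin s) 1 (by norm_num)
        (by nlinarith [Real.sin_sq_add_cos_sq s])
      rw [Real.norm_eq_abs]
      calc _ = |(f (ε * Real.cos s, ε * Real.sin s) - c₀) *
            ((Tf f (ε * Real.cos s, ε * Real.sin s)).1 * Real.cos s +
            (Tf f (ε * Real.cos s, ε * Real.sin s)).2 * Real.sin s)| := by congr 1; ring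
        _ ≤ _ := by
          rw [abs_mul]
          exact mul_le_of_le_one_right (abs_nonneg _) this
    · apply ii_of_contAt h12.le
      intro s hs
      exact ((arc_cont f ε s (hfc _ (hmem ε ⟨hρε, le_rfl⟩ s hs))).sub continuousAt_const).abs
  have U2 : |∫ s in θ₁..θ₂, ρ * ((f (ρ * Real.cos s, ρ * Real.sin s) - c₀) *
      (Tf f (ρ * Real.cos s, ρ * Real.sin s)).1 * Real.cos s -
      (f (ρ * Real.cos s, ρ * Real.sin s) - c₀) *
      (Tf f (ρ * Real.cos s, ρ * Real.sin s)).2 * -Real.sin s)| ≤ ρ * M * (θ₂ - θ₁) := by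
    rw [← abs_of_pos (sub_pos.2 h12), ← Real.norm_eq_abs]
    apply intervalIntegral.norm_integral_le_of_norm_le_const
    intro s hs
    rw [uIoc_of_le h12.le] at hs
    have := Tf_bound f (ρ * Real.cos s, ρ * Real.sin s) (Real.cos s) (Real.sin s) 1 (by norm_num)
        (by nlinarith [Real.sin_sq_add_cos_sq s])
    have q2 := hM _ (hmem ρ ⟨le_rfl, hρε⟩ s (Ioc_subset_Icc_self hs))
    rw [Real.norm_eq_abs, abs_mul, abs_of_pos hρ]
    gcongr
    calc _ = |(f (ρ * Real.cos s, ρ * Real.sin s) - c₀) *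
            ((Tf f (ρ * Real.cos s, ρ * Real.sin s)).1 * Real.cos s +
            (Tf f (ρ * Real.cos s, ρ * Real.sin s)).2 * Real.sin s)| := by congr 1; ring
        _ ≤ _ := by
          rw [abs_mul]
          exact (mul_le_of_le_one_right (abs_nonneg _) this).trans q2
  have U1' := (abs_le.1 U1).2
  have U2' := (abs_le.1 U2).1
  rw [P] at L
  have r : ∀ θ : ℝ, (∫ t in ρ..ε, ((f (t * Real.cos θ, t * Real.sin θ) - c₀) *
        (Tf f (t * Real.cos θ, t * Real.sin θ)).2 * Real.cos θ -
      (f (t * Real.cos θ, t * Real.sin θ) - c₀) *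
        (Tf f (t * Real.cos θ, t * Real.sin θ)).1 * Real.sin θ)) =
      (∫ t in ρ..ε, (f (t * Real.cos θ, t * Real.sin θ) - c₀) *
        ((Tf f (t * Real.cos θ, t * Real.sin θ)).2 * Real.cos θ -
          (Tf f (t * Real.cos θ, t * Real.sin θ)).1 * Real.sin θ)) := by
    intro θ
    congr 1; ext t; ring
  rw [r, r] at L
  linarith

lemma flux_lower {α δ κ lam₀ : ℝ} {γp γm : ℝ → ℝ} {f : ℝ × ℝ → ℝ} {R : ℝ → ℝ}
    (hα : α ∈ Ioo 0 π) (hδ : 0 < δ) (hsol : IsCapillarySolution α δ κ lam₀ γp γm f)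
    (hR : ∀ θ ∈ Ioo (-α) α, RadialLimitAt f θ (R θ))
    (θ₁ θ₂ τ : ℝ) (h1 : -α < θ₁) (h12 : θ₁ < θ₂) (h2 : θ₂ < α)
    (hmon : ∀ θ ∈ Icc θ₁ θ₂, R θ₁ ≤ R θ ∧ R θ ≤ R θ₂) (hd : R θ₁ < R θ₂) (hτ : 0 < τ) :
    ∀ᶠ ε in 𝓝[>] (0:ℝ), ε * (1 - (θ₂ - θ₁) - τ) ≤
      ∫ t in (ε ^ 2)..ε, ((Tf f (t * Real.cos θ₁, t * Real.sin θ₁)).2 * Real.cos θ₁ -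
          (Tf f (t * Real.cos θ₁, t * Real.sin θ₁)).1 * Real.sin θ₁) := by
  obtain ⟨M₀, hM₀⟩ := hsol.bounded
  set M := |M₀| + |R θ₂| with hMd
  set K := |κ| * |M₀| + |lam₀| with hKd
  have hM : ∀ p ∈ sector α δ, |f p - R θ₂| ≤ M := fun p hp =>
    (abs_sub _ _).trans (by have := hM₀ p hp; have := le_abs_self M₀; rw [hMd]; linarith)
  have hK : ∀ p ∈ sector α δ, |κ * f p + lam₀| ≤ K := fun p hp => by
    refine (abs_add_le _ _).trans ?_
    rw [abs_mul, hKd]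
    have := (hM₀ p hp).trans (le_abs_self M₀)
    gcongr
  have hM0 : 0 ≤ M := by positivity
  have hK0 : 0 ≤ K := by positivity
  set d := R θ₂ - R θ₁ with hdd
  have hd0 : 0 < d := sub_pos.2 hd
  set Δ := θ₂ - θ₁ with hΔ
  have hΔ0 : 0 < Δ := sub_pos.2 h12
  set σ := d * τ / 10 with hσ
  have hσ0 : 0 < σ := by positivity
  have dct : Tendsto (fun ε => ∫ s in θ₁..θ₂, |f (ε * Real.cos s, ε * Real.sin s) - R θ₂|)
      (𝓝[>] (0:ℝ)) (𝓝 (∫ s in θ₁..θ₂, |R s - R θ₂|)) := by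
    have hsm : ∀ᶠ ε in 𝓝[>] (0:ℝ), ε ∈ Ioo 0 δ := Ioo_mem_nhdsGT hδ
    apply intervalIntegral.tendsto_integral_filter_of_dominated_convergence (fun _ => M)
    · filter_upwards [hsm] with ε hε
      have : IntervalIntegrable (fun s => |f (ε * Real.cos s, ε * Real.sin s) - R θ₂|)
          volume θ₁ θ₂ := ii_of_contAt h12.le fun s hs =>
        ((arc_cont f ε s (cda hα hsol (mem_sec hε.1 hε.2 (by linarith [hs.1])
          (by linarith [hs.2]))).continuousAt).sub continuousAt_const).abs
      rw [uIoc_of_le h12.le]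
      exact this.1.aestronglyMeasurable
    · filter_upwards [hsm] with ε hε
      refine Eventually.of_forall fun s hs => ?_
      rw [uIoc_of_le h12.le] at hs
      rw [Real.norm_eq_abs, abs_abs]
      exact hM _ (mem_sec hε.1 hε.2 (by linarith [hs.1]) (by linarith [hs.2]))
    · simp
    · refine Eventually.of_forall fun s hs => ?_
      rw [uIoc_of_le h12.le] at hs
      exact ((hR s ⟨by linarith [hs.1], by linarith [hs.2]⟩).sub_const _).abs
  have lim_le : (∫ s in θ₁..θ₂, |R s - R θ₂|) ≤ d * Δ := by
    refine (le_abs_self _).trans ?_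
    rw [← Real.norm_eq_abs, ← abs_of_pos hΔ0]
    apply intervalIntegral.norm_integral_le_of_norm_le_const
    intro s hs
    rw [uIoc_of_le h12.le] at hs
    have := hmon s (Ioc_subset_Icc_self hs)
    rw [Real.norm_eq_abs, abs_abs, abs_of_nonpos (by linarith)]
    linarith
  have ev1 : ∀ᶠ ε in 𝓝[>] (0:ℝ),
      (∫ s in θ₁..θ₂, |f (ε * Real.cos s, ε * Real.sin s) - R θ₂|) < d * Δ + σ :=
    dct.eventually_lt_const (by linarith)
  have rad : ∀ θ ∈ Ioo (-α) α, ∀ᶠ ε in 𝓝[>] (0:ℝ), ∀ t ∈ Ioc 0 ε,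
      |f (t * Real.cos θ, t * Real.sin θ) - R θ| < σ := by
    intro θ hθ
    have := (Metric.tendsto_nhds.1 (hR θ hθ)) σ hσ0
    obtain ⟨e, he, hsub⟩ := mem_nhdsGT_iff_exists_Ioo_subset.1 this
    filter_upwards [Ioo_mem_nhdsGT he] with ε hε t ht
    exact hsub ⟨ht.1, lt_of_le_of_lt ht.2 hε.2⟩
  set C := (1 + M * K) * Δ + M * Δ + d with hC
  have hC0 : 0 < C := by positivity
  have ev2 : ∀ᶠ ε in 𝓝[>] (0:ℝ), ε ∈ Ioo 0 (min (min δ 1) (d * τ / 2 / C)) :=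
    Ioo_mem_nhdsGT (by positivity)
  filter_upwards [ev1, ev2, rad θ₁ ⟨h1, by linarith⟩, rad θ₂ ⟨by linarith, h2⟩] with ε h3 h4 h5 h6
  have hε0 := h4.1
  have hεδ : ε < δ := h4.2.trans_le ((min_le_left _ _).trans (min_le_left _ _))
  have hε1 : ε < 1 := h4.2.trans_le ((min_le_left _ _).trans (min_le_right _ _))
  have hεC : ε < d * τ / 2 / C := h4.2.trans_le (min_le_right _ _)
  have hεC' : ε * C < d * τ / 2 := (lt_div_iff₀ hC0).1 hεC
  have hρ0 : 0 < ε ^ 2 := by positivity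
  have hρε : ε ^ 2 ≤ ε := by nlinarith
  have E := energy_ineq hα hsol M K (R θ₂) θ₁ θ₂ (ε ^ 2) ε hM hK h1 h12 h2 hρ0 hρε hεδ
  have hmem : ∀ t ∈ Icc (ε ^ 2) ε, ∀ s ∈ Icc θ₁ θ₂,
      (t * Real.cos s, t * Real.sin s) ∈ sector α δ :=
    fun t ht s hs => mem_sec (by linarith [ht.1]) (by linarith [ht.2]) (by linarith [hs.1])
      (by linarith [hs.2])
  have hθ₁ : θ₁ ∈ Icc θ₁ θ₂ := ⟨le_rfl, h12.le⟩
  have hθ₂ : θ₂ ∈ Icc θ₁ θ₂ := ⟨h12.le, le_rfl⟩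
  have cf : ∀ θ ∈ Icc θ₁ θ₂, ∀ t ∈ Icc (ε ^ 2) ε,
      ContinuousAt (fun t => f (t * Real.cos θ, t * Real.sin θ)) t := fun θ hθ t ht =>
    ray_cont f _ _ t (cda hα hsol (hmem t ht θ hθ)).continuousAt
  have cT : ∀ θ ∈ Icc θ₁ θ₂, ∀ t ∈ Icc (ε ^ 2) ε,
      ContinuousAt (fun t => (Tf f (t * Real.cos θ, t * Real.sin θ)).2 * Real.cos θ -
          (Tf f (t * Real.cos θ, t * Real.sin θ)).1 * Real.sin θ) t := fun θ hθ t ht => by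
    have := Tf_cont ((cda hα hsol (hmem t ht θ hθ)).of_le (by norm_num : (1 : WithTop ℕ∞) ≤ 2))
    exact ((ray_cont _ _ _ t this.2).mul continuousAt_const).sub
      ((ray_cont _ _ _ t this.1).mul continuousAt_const)
  have bT : ∀ θ t : ℝ, |(Tf f (t * Real.cos θ, t * Real.sin θ)).2 * Real.cos θ -
          (Tf f (t * Real.cos θ, t * Real.sin θ)).1 * Real.sin θ| ≤ 1 := fun θ t => by
    have := Tf_bound f (t * Real.cos θ, t * Real.sin θ) (-Real.sin θ) (Real.cos θ) 1 (by norm_num)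
      (by nlinarith [Real.sin_sq_add_cos_sq θ])
    convert this using 2; ring
  have toIoc : ∀ t ∈ Icc (ε ^ 2) ε, t ∈ Ioc 0 ε := fun t ht => ⟨by linarith [ht.1], ht.2⟩
  have constI : ∀ c : ℝ, (∫ _ in (ε ^ 2)..ε, c) = c * (ε - ε ^ 2) := fun c => by simp; ring
  have I1 : (d - 2 * σ - (1 + M * K) * Δ * ε) * (ε - ε ^ 2) ≤ ∫ t in (ε ^ 2)..ε,
      (f (t * Real.cos θ₂, t * Real.sin θ₂) - f (t * Real.cos θ₁, t * Real.sin θ₁)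
        - (1 + M * K) * (θ₂ - θ₁) * ε) := by
    rw [← constI]
    apply intervalIntegral.integral_mono_on hρε (by simp)
    · exact ii_of_contAt hρε fun t ht =>
        ((cf θ₂ hθ₂ t ht).sub (cf θ₁ hθ₁ t ht)).sub continuousAt_const
    · intro t ht
      have a1 := abs_lt.1 (h5 t (toIoc t ht))
      have a2 := abs_lt.1 (h6 t (toIoc t ht))
      linarith [a1.1, a1.2, a2.1, a2.2]
  have I2 : (∫ t in (ε ^ 2)..ε, (f (t * Real.cos θ₂, t * Real.sin θ₂) - R θ₂) *
        ((Tf f (t * Real.cos θ₂, t * Real.sin θ₂)).2 * Real.cos θ₂ -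
          (Tf f (t * Real.cos θ₂, t * Real.sin θ₂)).1 * Real.sin θ₂)) ≤ σ * (ε - ε ^ 2) := by
    rw [← constI]
    apply intervalIntegral.integral_mono_on hρε _ (by simp)
    · intro t ht
      refine (le_abs_self _).trans ?_
      rw [abs_mul]
      exact (mul_le_of_le_one_right (abs_nonneg _) (bT _ _)).trans (h6 t (toIoc t ht)).le
    · exact ii_of_contAt hρε fun t ht =>
        ((cf θ₂ hθ₂ t ht).sub continuousAt_const).mul (cT θ₂ hθ₂ t ht)
  have I3 : -(∫ t in (ε ^ 2)..ε, (f (t * Real.cos θ₁, t * Real.sin θ₁) - R θ₂) *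
        ((Tf f (t * Real.cos θ₁, t * Real.sin θ₁)).2 * Real.cos θ₁ -
          (Tf f (t * Real.cos θ₁, t * Real.sin θ₁)).1 * Real.sin θ₁)) ≤
      d * (∫ t in (ε ^ 2)..ε, ((Tf f (t * Real.cos θ₁, t * Real.sin θ₁)).2 * Real.cos θ₁ -
          (Tf f (t * Real.cos θ₁, t * Real.sin θ₁)).1 * Real.sin θ₁)) + σ * (ε - ε ^ 2) := by
    rw [← constI, ← intervalIntegral.integral_neg, ← intervalIntegral.integral_const_mul,
      ← intervalIntegral.integral_add
        ((ii_of_contAt hρε (cT θ₁ hθ₁)).const_mul d) (by simp)]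
    apply intervalIntegral.integral_mono_on hρε
    · exact ii_of_contAt hρε fun t ht =>
        (((cf θ₁ hθ₁ t ht).sub continuousAt_const).mul (cT θ₁ hθ₁ t ht)).neg
    · exact ii_of_contAt hρε fun t ht =>
        (continuousAt_const.mul (cT θ₁ hθ₁ t ht)).add continuousAt_const
    · intro t ht
      have a1 : |(f (t * Real.cos θ₁, t * Real.sin θ₁) - R θ₁) *
        ((Tf f (t * Real.cos θ₁, t * Real.sin θ₁)).2 * Real.cos θ₁ -
          (Tf f (t * Real.cos θ₁, t * Real.sin θ₁)).1 * Real.sin θ₁)| ≤ σ := by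
        rw [abs_mul]
        exact (mul_le_of_le_one_right (abs_nonneg _) (bT _ _)).trans (h5 t (toIoc t ht)).le
      have a2 := (abs_le.1 a1).1
      rw [hdd]
      linear_combination a2
  set J := ∫ t in (ε ^ 2)..ε, ((Tf f (t * Real.cos θ₁, t * Real.sin θ₁)).2 * Real.cos θ₁ -
          (Tf f (t * Real.cos θ₁, t * Real.sin θ₁)).1 * Real.sin θ₁)
  have I4 : ε * (∫ s in θ₁..θ₂, |f (ε * Real.cos s, ε * Real.sin s) - R θ₂|) ≤
      ε * (d * Δ + σ) := by gcongr
  have fin : (d - 2 * σ - (1 + M * K) * Δ * ε) * (ε - ε ^ 2) ≤ σ * (ε - ε ^ 2) +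
      (d * J + σ * (ε - ε ^ 2)) + ε * (d * Δ + σ) + ε ^ 2 * M * Δ := by linarith
  have p1 : 0 ≤ (1 + M * K) * Δ * ε * ε ^ 2 := by positivity
  have p2 : 0 ≤ σ * ε ^ 2 := by positivity
  have p3 : ε * (ε * C) ≤ ε * (d * τ / 2) := by gcongr
  have p4 : d * (ε * (1 - Δ - τ)) ≤ d * J := by
    rw [hC] at p3
    have : σ * ε = d * τ / 10 * ε := by rw [hσ]
    linear_combination fin + p3 + p1 + 4 * p2 + 5 * this
  exact le_of_mul_le_mul_left p4 hd0

lemma tri_ineq {α δ κ lam₀ : ℝ} {γp γm : ℝ → ℝ} {f : ℝ × ℝ → ℝ}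
    (hα : α ∈ Ioo 0 π) (hδ : 0 < δ) (hsol : IsCapillarySolution α δ κ lam₀ γp γm f)
    (θ₁ lam : ℝ) (h1 : -α < θ₁) (h2 : θ₁ < α) (hl : α + θ₁ < lam) (hl' : lam < π) :
    ∃ C : ℝ, ∀ᶠ ε in 𝓝[>] (0:ℝ),
      (∫ t in (ε ^ 2)..ε, ((Tf f (t * Real.cos θ₁, t * Real.sin θ₁)).2 * Real.cos θ₁ -
          (Tf f (t * Real.cos θ₁, t * Real.sin θ₁)).1 * Real.sin θ₁)) +
      (∫ t in Ioo (0:ℝ) (Real.sin (lam - (α + θ₁)) / Real.sin lam * ε), Real.cos (γm t)) ≤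
      ε * (Real.sin (α + θ₁) / Real.sin lam) + C * ε ^ 2 := by
  obtain ⟨M₀, hM₀⟩ := hsol.bounded
  set K := |κ| * |M₀| + |lam₀| with hKd
  have hK : ∀ p ∈ sector α δ, |κ * f p + lam₀| ≤ K := fun p hp => by
    refine (abs_add_le _ _).trans ?_
    rw [abs_mul, hKd]
    have := (hM₀ p hp).trans (le_abs_self M₀)
    gcongr
  have hK0 : 0 ≤ K := by positivity
  set l := lam - α with hld
  set S := Real.sin (lam - (α + θ₁)) with hS
  have hS0 : 0 < S := Real.sin_pos_of_pos_of_lt_pi (by linarith) (by linarith)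
  have hsl : 0 < Real.sin lam := Real.sin_pos_of_pos_of_lt_pi (by linarith) hl'
  set b := S / Real.sin lam with hb
  have hb0 : 0 < b := by positivity
  set q : ℝ → ℝ := fun s => Real.sin (l - s) with hq
  have hq0 : ∀ s ∈ Icc (-α) θ₁, 0 < q s := fun s hs =>
    Real.sin_pos_of_pos_of_lt_pi (by linarith [hs.2]) (by linarith [hs.1])
  have hqd : ∀ s, HasDerivAt q (-Real.cos (l - s)) s := fun s => by
    have := ((hasDerivAt_id s).const_sub l).sin
    simpa using this
  set r : ℝ → ℝ := fun s => S / q s with hr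
  have hr0 : ∀ s ∈ Icc (-α) θ₁, 0 < r s := fun s hs => div_pos hS0 (hq0 s hs)
  have hrc : ContinuousOn r (Icc (-α) θ₁) := fun s hs =>
    (continuousAt_const.div (hqd s).continuousAt (hq0 s hs).ne').continuousWithinAt
  have hrb : r (-α) = b := by simp [hr, hq, hb, hld]
  have hr1 : r θ₁ = 1 := by
    have : q θ₁ = S := by simp only [hq, hS, hld]; congr 1; ring
    simp only [hr, this]; exact div_self hS0.ne'
  obtain ⟨B, hB⟩ : ∃ B, ∀ s ∈ Icc (-α) θ₁, r s ≤ B := by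
    obtain ⟨B, hB⟩ := isCompact_Icc.exists_bound_of_continuousOn hrc
    exact ⟨B, fun s hs => (le_abs_self _).trans (hB s hs)⟩
  have hB1 : 1 ≤ B := hr1 ▸ hB θ₁ ⟨h1.le, le_rfl⟩
  set c1 : ℝ → ℝ := fun s => r s * Real.cos s with hc1
  set c2 : ℝ → ℝ := fun s => r s * Real.sin s with hc2
  set d1 : ℝ → ℝ := fun s => S * Real.cos l / q s ^ 2 with hd1
  set d2 : ℝ → ℝ := fun s => S * Real.sin l / q s ^ 2 with hd2
  have hcl : ∀ s, Real.cos l = Real.cos (l - s) * Real.cos s - Real.sin (l - s) * Real.sin s := by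
    intro s; rw [← Real.cos_add]; congr 1; ring
  have hsinl : ∀ s, Real.sin l = Real.sin (l - s) * Real.cos s + Real.cos (l - s) * Real.sin s := by
    intro s; rw [← Real.sin_add]; congr 1; ring
  have hrd : ∀ s ∈ Icc (-α) θ₁, HasDerivAt r (S * Real.cos (l - s) / q s ^ 2) s := by
    intro s hs
    have := (hasDerivAt_const s S).fun_div (hqd s) (hq0 s hs).ne'
    refine this.congr_deriv ?_
    congr 1; ring
  have hc1d : ∀ s ∈ Icc (-α) θ₁, HasDerivAt c1 (d1 s) s := by
    intro s hs
    refine ((hrd s hs).mul (Real.hasDerivAt_cos s)).congr_deriv ?_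
    have := (hq0 s hs).ne'
    simp only [hd1, hr]
    rw [hcl s]
    change _ = S * (Real.cos (l - s) * Real.cos s - q s * Real.sin s) / q s ^ 2
    field_simp
    try ring
  have hc2d : ∀ s ∈ Icc (-α) θ₁, HasDerivAt c2 (d2 s) s := by
    intro s hs
    refine ((hrd s hs).mul (Real.hasDerivAt_sin s)).congr_deriv ?_
    have := (hq0 s hs).ne'
    simp only [hd2, hr]
    rw [hsinl s]
    change _ = S * (q s * Real.cos s + Real.cos (l - s) * Real.sin s) / q s ^ 2
    field_simp
    try ring
  have hdd : ∀ A : ℝ, ∀ s ∈ Icc (-α) θ₁, HasDerivAt (fun s => A / q s ^ 2)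
      (deriv (fun s => A / q s ^ 2) s) s := by
    intro A s hs
    have h0 := (hq0 s hs).ne'
    have : HasDerivAt (fun s => A / q s ^ 2) _ s :=
      (hasDerivAt_const s A).fun_div ((hqd s).fun_pow 2) (pow_ne_zero 2 h0)
    exact this.differentiableAt.hasDerivAt
  have hdet : ∀ s ∈ Icc (-α) θ₁, c1 s * d2 s - d1 s * c2 s = r s ^ 2 := by
    intro s hs
    have h0 := (hq0 s hs).ne'
    have : Real.sin l * Real.cos s - Real.cos l * Real.sin s = q s := by
      rw [← Real.sin_sub]
    simp only [hc1, hc2, hd1, hd2, hr]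
    have e : S / q s * Real.cos s * (S * Real.sin l / q s ^ 2) -
        S * Real.cos l / q s ^ 2 * (S / q s * Real.sin s) =
        S ^ 2 * (Real.sin l * Real.cos s - Real.cos l * Real.sin s) / q s ^ 3 := by
      field_simp
    rw [e, this]
    field_simp
  set L := Real.sin (α + θ₁) / Real.sin lam with hL
  have hlen : (∫ s in (-α)..θ₁, S / q s ^ 2) = L := by
    have : ∀ s ∈ uIcc (-α) θ₁, HasDerivAt (fun s => S * Real.cos (l - s) / q s) (S / q s ^ 2) s := by
      intro s hs
      rw [uIcc_of_le h1.le] at hs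
      have h0 := (hq0 s hs).ne'
      have c : HasDerivAt (fun s => Real.cos (l - s)) (Real.sin (l - s)) s := by
        have := ((hasDerivAt_id s).const_sub l).cos
        simpa using this
      refine ((c.const_mul S).fun_div (hqd s) h0).congr_deriv ?_
      congr 1
      have := Real.sin_sq_add_cos_sq (l - s)
      simp only [hq]
      linear_combination S * this
    rw [intervalIntegral.integral_eq_sub_of_hasDerivAt this]
    · have e1 : q θ₁ = S := by simp only [hq, hS, hld]; congr 1; ring
      have e2 : q (-α) = Real.sin lam := by simp [hq, hld]
      have e3 : l - -α = lam := by rw [hld]; ring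
      rw [e1, e2, e3, hL]
      have e4 : α + θ₁ = lam - (l - θ₁) := by rw [hld]; ring
      have e5 : Real.sin (l - θ₁) = S := e1
      rw [e4, Real.sin_sub, e5]
      field_simp
    · exact ii_of_contAt h1.le fun s hs => (hdd S s hs).continuousAt
  have hu : ∀ p, ∀ s ∈ Icc (-α) θ₁, |(Tf f p).1 * d2 s - (Tf f p).2 * d1 s| ≤ S / q s ^ 2 := by
    intro p s hs
    have h0 := hq0 s hs
    have := Tf_bound f p (d2 s) (-d1 s) (S / q s ^ 2) (by positivity) (by
      have e : d2 s ^ 2 + (-d1 s) ^ 2 =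
          (S / q s ^ 2) ^ 2 * (Real.sin l ^ 2 + Real.cos l ^ 2) := by
        simp only [hd1, hd2]; ring
      rw [e, Real.sin_sq_add_cos_sq, mul_one])
    convert this using 2; ring
  have hcosI : ∀ x y : ℝ, IntervalIntegrable (fun t => Real.cos (γm t)) volume x y := by
    intro x y
    refine (intervalIntegrable_const (c := (1:ℝ))).mono_fun
      (Real.measurable_cos.comp hsol.measurable_γm).aestronglyMeasurable ?_
    refine Eventually.of_forall fun t => ?_
    simpa using Real.abs_cos_le_one (γm t)
  refine ⟨B ^ 2 * K * (θ₁ + α) + L + b, ?_⟩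
  filter_upwards [Ioo_mem_nhdsGT (show (0:ℝ) < min 1 (δ / B) by positivity)] with ε hε
  have hε0 := hε.1
  have hε1 : ε < 1 := hε.2.trans_le (min_le_left _ _)
  have hεB : ε * B < δ := (lt_div_iff₀ (by positivity)).1 (hε.2.trans_le (min_le_right _ _))
  have hρ0 : 0 < ε ^ 2 := by positivity
  have hρε : ε ^ 2 ≤ ε := by nlinarith
  have hlt : ∀ t ∈ Icc (ε ^ 2) ε, ∀ s ∈ Icc (-α) θ₁, 0 < t * r s ∧ t * r s < δ := by
    intro t ht s hs
    have t0 : 0 < t := hρ0.trans_le ht.1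
    refine ⟨mul_pos t0 (hr0 s hs), lt_of_le_of_lt ?_ hεB⟩
    have := hB s hs
    have := ht.2
    gcongr
    exact (hr0 s hs).le
  have hpt : ∀ t s, (t * c1 s, t * c2 s) = ((t * r s) * Real.cos s, (t * r s) * Real.sin s) := by
    intro t s; simp only [hc1, hc2, mul_assoc]
  have hmem : ∀ t ∈ Icc (ε ^ 2) ε, ∀ s ∈ Icc (-α) θ₁, -α < s →
      (t * c1 s, t * c2 s) ∈ sector α δ := by
    intro t ht s hs hs'
    rw [hpt]
    exact mem_sec (hlt t ht s hs).1 (hlt t ht s hs).2 hs' (by linarith [hs.2])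
  have hedge : ∀ t, (t * c1 (-α), t * c2 (-α)) =
      ((t * b) * Real.cos α, -((t * b) * Real.sin α)) := by
    intro t; rw [hpt, hrb]; simp
  have hC1 : ∀ t ∈ Icc (ε ^ 2) ε, ∀ s ∈ Icc (-α) θ₁, ContDiffAt ℝ 1 f (t * c1 s, t * c2 s) := by
    intro t ht s hs
    rcases eq_or_lt_of_le hs.1 with h | h
    · rw [← h, hedge]
      have := hlt t ht (-α) ⟨le_rfl, h1.le⟩
      rw [hrb] at this
      exact hsol.edgeM_smooth _ this
    · exact (cda hα hsol (hmem t ht s hs h)).of_le (by norm_num)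
  have P := piola (fun p => (Tf f p).1) (fun p => (Tf f p).2) (fun p => κ * f p + lam₀)
    c1 c2 d1 d2 _ _ (ε ^ 2) ε (-α) θ₁ hρε h1.le hc1d hc2d (hdd _) (hdd _)
    (fun t ht s hs => (Tf_cont (hC1 t ht s hs)).1)
    (fun t ht s hs => (Tf_cont (hC1 t ht s hs)).2)
    (fun t ht s hs => (continuousAt_const.mul (hC1 t ht s hs).continuousAt).add continuousAt_const)
    (by
      intro t ht s hs
      have hp := hmem t (Ioo_subset_Icc_self ht) s (Ioo_subset_Icc_self hs) hs.1
      have := Tf_diff (cda hα hsol hp)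
      exact ⟨this.1, this.2, hsol.pde _ hp⟩)
  have hα0 : 0 < θ₁ + α := by linarith
  have Q1 : |∫ t in (ε ^ 2)..ε, ∫ s in (-α)..θ₁, t * (c1 s * d2 s - d1 s * c2 s) *
      (κ * f (t * c1 s, t * c2 s) + lam₀)| ≤ ε * B ^ 2 * K * (θ₁ + α) * ε := by
    have : |∫ t in (ε ^ 2)..ε, ∫ s in (-α)..θ₁, t * (c1 s * d2 s - d1 s * c2 s) *
      (κ * f (t * c1 s, t * c2 s) + lam₀)| ≤ ε * B ^ 2 * K * (θ₁ + α) * |ε - ε ^ 2| := by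
      rw [← Real.norm_eq_abs]
      apply intervalIntegral.norm_integral_le_of_norm_le_const
      intro t ht
      rw [uIoc_of_le hρε] at ht
      have e : θ₁ + α = |θ₁ - -α| := by rw [sub_neg_eq_add, abs_of_pos hα0]
      rw [e]
      apply intervalIntegral.norm_integral_le_of_norm_le_const
      intro s hs
      rw [uIoc_of_le h1.le] at hs
      have hs' := Ioc_subset_Icc_self hs
      have ht' := Ioc_subset_Icc_self ht
      have := hK _ (hmem t ht' s hs' hs.1)
      have t0 : 0 < t := hρ0.trans ht.1
      have := hB s hs'
      have := hr0 s hs'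
      have := ht.2
      rw [hdet s hs', norm_mul, norm_mul, Real.norm_eq_abs, Real.norm_eq_abs, Real.norm_eq_abs,
        abs_of_pos t0, abs_of_pos (by positivity)]
      gcongr
    refine this.trans ?_
    rw [abs_of_nonneg (by linarith)]
    gcongr
    linarith
  have Q2 : ∀ e : ℝ, 0 < e → |∫ s in (-α)..θ₁, e * ((Tf f (e * c1 s, e * c2 s)).1 * d2 s -
      (Tf f (e * c1 s, e * c2 s)).2 * d1 s)| ≤ e * L := by
    intro e he
    rw [intervalIntegral.integral_const_mul, abs_mul, abs_of_pos he, ← hlen]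
    gcongr
    rw [← Real.norm_eq_abs]
    apply intervalIntegral.norm_integral_le_of_norm_le h1.le
    · exact Eventually.of_forall fun s hs => hu _ s (Ioc_subset_Icc_self hs)
    · exact ii_of_contAt h1.le fun s hs => (hdd S s hs).continuousAt
  have Q3 : (∫ t in (ε ^ 2)..ε, ((Tf f (t * c1 (-α), t * c2 (-α))).2 * c1 (-α) -
      (Tf f (t * c1 (-α), t * c2 (-α))).1 * c2 (-α))) =
      -(∫ t in (ε ^ 2 * b)..(ε * b), Real.cos (γm t)) := by
    rw [← intervalIntegral.mul_integral_comp_mul_right, ← intervalIntegral.integral_const_mul,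
      ← intervalIntegral.integral_neg]
    apply intervalIntegral.integral_congr
    intro t ht
    rw [uIcc_of_le hρε] at ht
    have hh := hlt t ht (-α) ⟨le_rfl, h1.le⟩
    rw [hrb] at hh
    have bc := hsol.bcM _ hh
    simp only
    rw [hedge, ← bc]
    simp only [dot, hc1, hc2, hrb, Real.cos_neg, Real.sin_neg]
    ring
  have Q4 : (∫ t in Ioo (0:ℝ) (b * ε), Real.cos (γm t)) =
      (∫ t in (0:ℝ)..(ε ^ 2 * b), Real.cos (γm t)) +
        ∫ t in (ε ^ 2 * b)..(ε * b), Real.cos (γm t) := by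
    rw [intervalIntegral.integral_add_adjacent_intervals (hcosI _ _) (hcosI _ _),
      intervalIntegral.integral_of_le (by positivity), integral_Ioc_eq_integral_Ioo, mul_comm]
  have Q5 : (∫ t in (0:ℝ)..(ε ^ 2 * b), Real.cos (γm t)) ≤ ε ^ 2 * b := by
    refine (le_abs_self _).trans ?_
    rw [← Real.norm_eq_abs]
    have := intervalIntegral.norm_integral_le_of_norm_le_const (a := 0) (b := ε ^ 2 * b) (C := 1)
      (f := fun t => Real.cos (γm t)) (fun t _ => Real.abs_cos_le_one _)
    rwa [sub_zero, abs_of_pos (by positivity), one_mul] at this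
  have Q6 : c1 θ₁ = Real.cos θ₁ ∧ c2 θ₁ = Real.sin θ₁ := by
    simp only [hc1, hc2, hr1, one_mul, and_self]
  simp only [Q6.1, Q6.2] at P
  rw [Q3] at P
  have R1 := (abs_le.1 Q1).2
  have R2 := (abs_le.1 (Q2 ε hε0)).1
  have R3 := (abs_le.1 (Q2 (ε ^ 2) hρ0)).2
  rw [Q4]
  nlinarith

lemma fan_bound {α δ κ lam₀ : ℝ} {γp γm : ℝ → ℝ} {f : ℝ × ℝ → ℝ} {R : ℝ → ℝ}
    (hα : α ∈ Ioo 0 π) (hδ : 0 < δ) (hsol : IsCapillarySolution α δ κ lam₀ γp γm f)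
    (hR : ∀ θ ∈ Ioo (-α) α, RadialLimitAt f θ (R θ))
    (θ₁ η lam : ℝ) (h1 : -α < θ₁) (h2 : θ₁ < α) (hη : 0 < η)
    (hmono : StrictMonoOn R (Icc θ₁ (θ₁ + η) ∩ Ioo (-α) α))
    (hl : α + θ₁ < lam) (hl' : lam < π) :
    1 + fanAS γm (Real.sin (lam - (α + θ₁)) / Real.sin lam) ≤
        Real.sin (α + θ₁) / Real.sin lam := by
  apply le_of_forall_pos_le_add
  intro τ hτ
  obtain ⟨C, hC⟩ := tri_ineq hα hδ hsol θ₁ lam h1 h2 hl hl'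
  set x := min (min (η / 2) ((α - θ₁) / 2)) (τ / 3) with hx
  have hx0 : 0 < x := by
    have : 0 < α - θ₁ := by linarith
    positivity
  have x1 : x ≤ η / 2 := (min_le_left _ _).trans (min_le_left _ _)
  have x2 : x ≤ (α - θ₁) / 2 := (min_le_left _ _).trans (min_le_right _ _)
  have x3 : x ≤ τ / 3 := min_le_right _ _
  have hin : ∀ θ ∈ Icc θ₁ (θ₁ + x), θ ∈ Icc θ₁ (θ₁ + η) ∩ Ioo (-α) α := fun θ hθ =>
    ⟨⟨hθ.1, by linarith [hθ.2]⟩, by linarith [hθ.1], by linarith [hθ.2]⟩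
  have i1 := hin θ₁ ⟨le_rfl, by linarith⟩
  have i2 := hin (θ₁ + x) ⟨by linarith, le_rfl⟩
  have F := flux_lower hα hδ hsol hR θ₁ (θ₁ + x) (τ / 3) h1 (by linarith) (by linarith)
    (fun θ hθ => ⟨hmono.monotoneOn i1 (hin θ hθ) hθ.1, hmono.monotoneOn (hin θ hθ) i2 hθ.2⟩)
    (hmono i1 i2 (by linarith)) (by positivity)
  set b := Real.sin (lam - (α + θ₁)) / Real.sin lam with hb
  have hS0 : 0 < Real.sin (lam - (α + θ₁)) :=
    Real.sin_pos_of_pos_of_lt_pi (by linarith) (by linarith)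
  have hsl : 0 < Real.sin lam := Real.sin_pos_of_pos_of_lt_pi (by linarith) hl'
  have hb0 : 0 < b := by positivity
  set L := Real.sin (α + θ₁) / Real.sin lam with hL
  suffices h : fanAS γm b ≤ L - 1 + τ by linarith
  have lower : ∀ᶠ ε in 𝓝[>] (0:ℝ),
      -b ≤ ε⁻¹ * ∫ t in Ioo (0:ℝ) (b * ε), Real.cos (γm t) := by
    filter_upwards [self_mem_nhdsWithin] with ε hε
    have hε : 0 < ε := hε
    have : |∫ t in (0:ℝ)..(b * ε), Real.cos (γm t)| ≤ 1 * |b * ε - 0| := by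
      rw [← Real.norm_eq_abs]
      exact intervalIntegral.norm_integral_le_of_norm_le_const
        (fun t _ => Real.abs_cos_le_one _)
    rw [intervalIntegral.integral_of_le (by positivity), integral_Ioc_eq_integral_Ioo, sub_zero,
      abs_of_pos (show 0 < b * ε by positivity)] at this
    have := (abs_le.1 this).1
    rw [inv_mul_eq_div, le_div_iff₀ hε]
    linarith
  have upper : ∀ᶠ ε in 𝓝[>] (0:ℝ),
      ε⁻¹ * (∫ t in Ioo (0:ℝ) (b * ε), Real.cos (γm t)) ≤ L - 1 + τ := by
    have hp : 0 < τ / 3 / (|C| + 1) := by positivity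
    filter_upwards [F, hC, Ioo_mem_nhdsGT hp] with ε e1 e2 e3
    have hε := e3.1
    have e4 : ε * (|C| + 1) < τ / 3 := (lt_div_iff₀ (by positivity)).1 e3.2
    have e5 : C * ε ≤ τ / 3 := by
      have := le_abs_self C
      nlinarith
    rw [inv_mul_eq_div, div_le_iff₀ hε]
    have e6 : θ₁ + x - θ₁ = x := by ring
    rw [e6] at e1
    nlinarith [mul_le_mul_of_nonneg_left e5 hε.le, mul_le_mul_of_nonneg_left x3 hε.le]
  exact limsup_le_of_le (isCoboundedUnder_le_of_eventually_le _ lower) upper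

/-- Bound for an increasing lower side fan: if `Rf` is constant on
`(−α, α₁]` and strictly increasing on `[α₁, α₁ + η] ∩ (−α, α)`, then with `β⁻ = α + α₁`,
for every `λ ∈ (β⁻, π)` one has
`1 + A⁻_S(sin(λ−β⁻)/sin λ) ≤ sin β⁻ / sin λ`. -/
theorem lower_fan_increasing_bound
    (α δ κ lam₀ : ℝ) (γp γm : ℝ → ℝ) (f : ℝ × ℝ → ℝ) (R : ℝ → ℝ)
    (hα : α ∈ Ioo 0 π) (hδ : 0 < δ)
    (hsol : IsCapillarySolution α δ κ lam₀ γp γm f)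
    (hdisc : DiscontinuousAtCorner α δ f)
    (hR : ∀ θ ∈ Ioo (-α) α, RadialLimitAt f θ (R θ))
    (α₁ η : ℝ) (hα₁ : α₁ ∈ Ico (-α) α) (hη : 0 < η)
    (hconst : ∃ c : ℝ, ∀ θ ∈ Ioc (-α) α₁, R θ = c)
    (hmono : StrictMonoOn R (Icc α₁ (α₁ + η) ∩ Ioo (-α) α)) :
    ∀ lam ∈ Ioo (α + α₁) π,
      1 + fanAS γm (Real.sin (lam - (α + α₁)) / Real.sin lam) ≤
        Real.sin (α + α₁) / Real.sin lam := by
  intro lam hlam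
  rcases eq_or_lt_of_le hα₁.1 with h | h
  · -- degenerate lower fan
    have e0 : α + α₁ = 0 := by rw [← h]; ring
    have hsl : 0 < Real.sin lam :=
      Real.sin_pos_of_pos_of_lt_pi (by linarith [hlam.1]) hlam.2
    rw [e0, sub_zero, div_self hsl.ne', Real.sin_zero, zero_div]
    apply le_of_forall_pos_le_add
    intro τ hτ
    set x := min (min (η / 2) α) (min τ (π / 2)) with hx
    have hx0 : 0 < x := by
      have := hα.1
      have := Real.pi_pos
      positivity
    have x1 : x ≤ η / 2 := (min_le_left _ _).trans (min_le_left _ _)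
    have x2 : x ≤ α := (min_le_left _ _).trans (min_le_right _ _)
    have x3 : x ≤ τ := (min_le_right _ _).trans (min_le_left _ _)
    have x4 : x ≤ π / 2 := (min_le_right _ _).trans (min_le_right _ _)
    have hpi := Real.pi_pos
    have key := fan_bound hα hδ hsol hR (-α + x) (η / 2) ((π + x) / 2) (by linarith)
      (by linarith [hα.1]) (by positivity)
      (hmono.mono (by
        rintro θ ⟨⟨a1, a2⟩, a3⟩
        exact ⟨⟨by linarith, by linarith⟩, a3⟩)) (by linarith) (by linarith)
    have e1 : α + (-α + x) = x := by ring
    rw [e1] at key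
    have e2 : Real.sin ((π + x) / 2) = Real.cos (x / 2) := by
      rw [← Real.sin_add_pi_div_two]; congr 1; ring
    have e3 : Real.sin ((π + x) / 2 - x) = Real.cos (x / 2) := by
      rw [← Real.sin_pi_div_two_sub]; congr 1; ring
    have e4 : 0 < Real.cos (x / 2) := Real.cos_pos_of_mem_Ioo ⟨by linarith, by linarith⟩
    have e5 : Real.sin x = 2 * Real.sin (x / 2) * Real.cos (x / 2) := by
      rw [← Real.sin_two_mul]; congr 1; ring
    rw [e2, e3, div_self e4.ne', e5, mul_div_assoc, div_self e4.ne', mul_one] at key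
    have e6 : Real.sin (x / 2) ≤ x / 2 := Real.sin_le (by positivity)
    linarith
  · exact fan_bound hα hδ hsol hR α₁ η lam h hα₁.2 hη hmono hlam.1 hlam.2
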